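/- Content of Lemma 8.4 (the endpoint image of the local Morse–Bott moduli space is a chart image): (1) the unbroken endpoint set satisfies E_r = {((x₀, y₀), (e^{−2T} x₀, e^{2T} y₀)) : x₀ ∈ ℝ^s, y₀ ∈ ℝ^u, ‖x₀‖ = r, 0 < ‖y₀‖ < r, T ≥ 0, e^{2T}‖y₀‖ = r}, i.e. E_r is exactly the set of endpoint pairs of gradient trajectories t ↦ (e^{−2t}x₀, e^{2t}y₀) launched from {‖x‖ = r, ‖y‖ < r} at the time they reach {‖y‖ = r}; (2) the map Φ : [0,1) × S^{s−1}_r × S^{u−1}_r → (ℝ^s × ℝ^u) × (ℝ^s × ℝ^u), Φ(t, x, y) := (x, t·y, t·x, y), is injective, is a homeomorphism onto its image (a topological embedding), and its image is exactly E_r ∪ B_r. -/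

import Mathlib

/-!
Content of Lemma 8.4: the endpoint image of the local Morse–Bott moduli space is a chart
image.

For `f(x, y) = ‖y‖² - ‖x‖²` on `ℝ^s × ℝ^u` with the Euclidean metric, the gradient
trajectories are `t ↦ (e^{-2t} x₀, e^{2t} y₀)`.  `E_r` records an unbroken trajectory by
its entry point on `{‖x‖ = r}` and its exit point on `{‖y‖ = r}`, and `B_r` records the
once-broken trajectories through the critical point at the origin.
-/

/-- The factor `ℝ^k` with its Euclidean norm. -/
abbrev Euc (k : ℕ) := EuclideanSpace ℝ (Fin k)

/-- The unbroken endpoint set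
`E_r = {(x, y, (‖y‖/r)·x, (r/‖y‖)·y) : ‖x‖ = r, 0 < ‖y‖ < r}`. -/
def endptE (s u : ℕ) (r : ℝ) : Set ((Euc s × Euc u) × (Euc s × Euc u)) :=
  {p | ∃ (x : Euc s) (y : Euc u), ‖x‖ = r ∧ 0 < ‖y‖ ∧ ‖y‖ < r ∧
    p = ((x, y), ((‖y‖ / r) • x, (r / ‖y‖) • y))}

/-- The broken endpoint set `B_r = {(x, 0, 0, y) : ‖x‖ = r, ‖y‖ = r}`. -/
def endptB (s u : ℕ) (r : ℝ) : Set ((Euc s × Euc u) × (Euc s × Euc u)) :=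
  {p | ∃ (x : Euc s) (y : Euc u), ‖x‖ = r ∧ ‖y‖ = r ∧ p = ((x, 0), (0, y))}

/-- The chart map `Φ(t, x, y) = (x, t·y, t·x, y)`. -/
noncomputable def chartPhi (s u : ℕ) : ℝ × Euc s × Euc u → (Euc s × Euc u) × (Euc s × Euc u) :=
  fun p => ((p.2.1, p.1 • p.2.2), (p.1 • p.2.1, p.2.2))

/-- The chart domain `[0, 1) × S^{s-1}_r × S^{u-1}_r`. -/
def chartDom (s u : ℕ) (r : ℝ) : Set (ℝ × Euc s × Euc u) :=
  Set.Ico (0 : ℝ) 1 ×ˢ (Metric.sphere (0 : Euc s) r ×ˢ Metric.sphere (0 : Euc u) r)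

/-- The continuous map `((x, y), (x', y')) ↦ (‖y‖ / r, x, y')`, a left inverse of the chart. -/
noncomputable def chartPhiInv (s u : ℕ) (r : ℝ) :
    (Euc s × Euc u) × (Euc s × Euc u) → ℝ × Euc s × Euc u :=
  fun q => (‖q.1.2‖ / r, q.1.1, q.2.2)

theorem continuous_chartPhi (s u : ℕ) : Continuous (chartPhi s u) := by
  unfold chartPhi
  fun_prop

theorem continuous_chartPhiInv (s u : ℕ) (r : ℝ) : Continuous (chartPhiInv s u r) := by
  unfold chartPhiInv
  fun_prop

theorem leftInvOn_chartPhiInv (s u : ℕ) {r : ℝ} (hr : 0 < r) :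
    Set.LeftInvOn (chartPhiInv s u r) (chartPhi s u) (chartDom s u r) := by
  rintro ⟨t, x, y⟩ ⟨⟨ht, -⟩, -, hy⟩
  have hy' : ‖y‖ = r := by simpa using hy
  have h : ‖t • y‖ / r = t := by
    rw [norm_smul, hy', Real.norm_of_nonneg ht, mul_div_cancel_right₀ _ hr.ne']
  simp only [chartPhi, chartPhiInv, h]

theorem isEmbedding_restrict_chartPhi (s u : ℕ) {r : ℝ} (hr : 0 < r) :
    Topology.IsEmbedding ((chartDom s u r).restrict (chartPhi s u)) := by
  refine .of_comp ((continuous_chartPhi s u).comp continuous_subtype_val)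
    (continuous_chartPhiInv s u r) ?_
  have h : chartPhiInv s u r ∘ (chartDom s u r).restrict (chartPhi s u) = Subtype.val :=
    funext fun p => leftInvOn_chartPhiInv s u hr p.2
  rw [h]
  exact .subtypeVal

theorem endptE_eq_trajectories (s u : ℕ) {r : ℝ} (hr : 0 < r) :
    endptE s u r = {p | ∃ (x₀ : Euc s) (y₀ : Euc u) (T : ℝ),
        ‖x₀‖ = r ∧ 0 < ‖y₀‖ ∧ ‖y₀‖ < r ∧ 0 ≤ T ∧ Real.exp (2 * T) * ‖y₀‖ = r ∧
        p = ((x₀, y₀), (Real.exp (-2 * T) • x₀, Real.exp (2 * T) • y₀))} := by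
  have exp_neg_eq {T a : ℝ} (h : Real.exp (2 * T) = r / a) : Real.exp (-2 * T) = a / r := by
    rw [neg_mul, Real.exp_neg, h, inv_div]
  ext p
  constructor
  · rintro ⟨x, y, hx, hy, hyr, rfl⟩
    have hT : Real.exp (2 * (Real.log (r / ‖y‖) / 2)) = r / ‖y‖ := by
      rw [mul_div_cancel₀ _ two_ne_zero, Real.exp_log (div_pos hr hy)]
    refine ⟨x, y, Real.log (r / ‖y‖) / 2, hx, hy, hyr, ?_, ?_, ?_⟩
    · exact div_nonneg (Real.log_nonneg ((one_le_div hy).2 hyr.le)) zero_le_two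
    · rw [hT, div_mul_cancel₀ _ hy.ne']
    · rw [exp_neg_eq hT, hT]
  · rintro ⟨x, y, T, hx, hy, hyr, -, hTr, rfl⟩
    have hT : Real.exp (2 * T) = r / ‖y‖ := (eq_div_iff hy.ne').2 hTr
    exact ⟨x, y, hx, hy, hyr, by rw [exp_neg_eq hT, hT]⟩

theorem image_chartPhi (s u : ℕ) {r : ℝ} (hr : 0 < r) :
    chartPhi s u '' chartDom s u r = endptE s u r ∪ endptB s u r := by
  ext p
  constructor
  · rintro ⟨⟨t, x, y⟩, ⟨⟨ht, ht1⟩, hx, hy⟩, rfl⟩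
    have hx' : ‖x‖ = r := by simpa using hx
    have hy' : ‖y‖ = r := by simpa using hy
    simp only at ht ht1
    rcases ht.eq_or_lt with rfl | ht
    · exact .inr ⟨x, y, hx', hy', by simp [chartPhi]⟩
    · have hn : ‖t • y‖ = t * r := by rw [norm_smul, hy', Real.norm_of_nonneg ht.le]
      refine .inl ⟨x, t • y, hx', ?_, ?_, ?_⟩
      · rw [hn]
        positivity
      · rw [hn]
        exact mul_lt_of_lt_one_left hr ht1
      · have h₁ : t * r / r = t := mul_div_cancel_right₀ _ hr.ne'
        have h₂ : r / (t * r) * t = 1 := by field_simp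
        rw [hn, h₁, smul_smul, h₂, one_smul]
        rfl
  · rintro (⟨x, y, hx, hy, hyr, rfl⟩ | ⟨x, y, hx, hy, rfl⟩)
    · refine ⟨(‖y‖ / r, x, (r / ‖y‖) • y), ⟨⟨by positivity, (div_lt_one hr).2 hyr⟩, ?_, ?_⟩, ?_⟩
      · simpa using hx
      · rw [mem_sphere_zero_iff_norm, norm_smul, Real.norm_of_nonneg (by positivity),
          div_mul_cancel₀ _ hy.ne']
      · have h : ‖y‖ / r * (r / ‖y‖) = 1 := by field_simp
        simp only [chartPhi, smul_smul, h, one_smul]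
    · exact ⟨(0, x, y), ⟨⟨le_rfl, one_pos⟩, by simpa using hx, by simpa using hy⟩,
        by simp [chartPhi]⟩

/-- **Lemma 8.4 (content).**
(1) `E_r` is exactly the set of endpoint pairs
`((x₀, y₀), (e^{-2T} x₀, e^{2T} y₀))` of gradient trajectories launched from
`{‖x‖ = r, ‖y‖ < r}` at the time `T ≥ 0` they reach `{‖y‖ = r}` (i.e. with
`e^{2T}‖y₀‖ = r`);
(2) the map `Φ : [0,1) × S^{s-1}_r × S^{u-1}_r → (ℝ^s × ℝ^u) × (ℝ^s × ℝ^u)`,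
`Φ(t, x, y) = (x, t·y, t·x, y)`, is injective, is a homeomorphism onto its image (a
topological embedding), and its image is exactly `E_r ∪ B_r`. -/
theorem statement13 (s u : ℕ) (hs : 0 < s) (hu : 0 < u) (r : ℝ) (hr : 0 < r) :
    (endptE s u r = {p | ∃ (x₀ : Euc s) (y₀ : Euc u) (T : ℝ),
        ‖x₀‖ = r ∧ 0 < ‖y₀‖ ∧ ‖y₀‖ < r ∧ 0 ≤ T ∧ Real.exp (2 * T) * ‖y₀‖ = r ∧
        p = ((x₀, y₀), (Real.exp (-2 * T) • x₀, Real.exp (2 * T) • y₀))}) ∧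
    Set.InjOn (chartPhi s u) (chartDom s u r) ∧
    Topology.IsEmbedding ((chartDom s u r).restrict (chartPhi s u)) ∧
    chartPhi s u '' chartDom s u r = endptE s u r ∪ endptB s u r := by
  exact ⟨endptE_eq_trajectories s u hr, (leftInvOn_chartPhiInv s u hr).injOn,
    isEmbedding_restrict_chartPhi s u hr, image_chartPhi s u hr⟩
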